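/- arXiv:2010.07372 — 2 statements merged into one kernel-verified Lean document; each statement's English description precedes it below -/
import Mathlib

section
/- Let H be a separable complex Hilbert space, let (e_i) be a frame of H, and let T be a bounded operator on H. If the series ∑_{i=1}^∞ ‖T e_i‖² converges, then T is a Hilbert–Schmidt operator, i.e. ∑_{i=1}^∞ ‖T f_i‖² converges for every orthonormal basis (f_i) of H. -/
open ContinuousLinearMap Filter Topology

noncomputable section

variable {H : Type*} [NormedAddCommGroup H] [InnerProductSpace ℂ H] [CompleteSpace H]
  [TopologicalSpace.SeparableSpace H]

local notation "⟪" x ", " y "⟫" => @inner ℂ _ _ x y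

/-- A frame of a Hilbert space: `⟨v,w⟩ = ∑ᵢ ⟨v,eᵢ⟩⟨eᵢ,w⟩` for all `v, w`. -/
def IsFrame (e : ℕ → H) : Prop :=
  ∀ v w : H, HasSum (fun i => ⟪v, e i⟫ * ⟪e i, w⟫) ⟪v, w⟫

theorem HilbertBasis.isFrame (f : HilbertBasis ℕ ℂ H) : IsFrame f :=
  fun v w => f.hasSum_inner_mul_inner v w

/-- Parseval's identity for a frame. -/
theorem IsFrame.hasSum_norm_inner_sq {e : ℕ → H} (he : IsFrame e) (v : H) :
    HasSum (fun i => ‖⟪v, e i⟫‖ ^ 2) (‖v‖ ^ 2) := by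
  rw [← Complex.hasSum_ofReal]
  convert he v v using 1
  · funext i
    rw [← inner_conj_symm (e i) v, RCLike.mul_conj]
    simp
  · rw [inner_self_eq_norm_sq_to_K]
    simp

theorem IsFrame.summable_norm_adjoint_sq {e f : ℕ → H} (he : IsFrame e) (hf : IsFrame f)
    (T : H →L[ℂ] H) (h : Summable fun i => ‖T (e i)‖ ^ 2) :
    Summable fun j => ‖adjoint T (f j)‖ ^ 2 := by
  have h_prod : Summable fun p : ℕ × ℕ => ‖⟪T (e p.1), f p.2⟫‖ ^ 2 := by
    refine (summable_prod_of_nonneg fun p => sq_nonneg _).2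
      ⟨fun i => (hf.hasSum_norm_inner_sq (T (e i))).summable, ?_⟩
    exact h.congr fun i => ((hf.hasSum_norm_inner_sq (T (e i))).tsum_eq).symm
  refine h_prod.prod_symm.prod.congr fun j => ?_
  rw [← (he.hasSum_norm_inner_sq (adjoint T (f j))).tsum_eq]
  refine tsum_congr fun i => ?_
  rw [adjoint_inner_left, norm_inner_symm]
  rfl

/-- if `∑ᵢ ‖T eᵢ‖²` converges for some frame `e`, then `T` is
Hilbert–Schmidt: `∑ᵢ ‖T fᵢ‖²` converges for every orthonormal basis `f` of `H`. -/
theorem hilbertSchmidt_of_frame_summable (e : ℕ → H) (he : IsFrame e) (T : H →L[ℂ] H)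
    (h : Summable fun i => ‖T (e i)‖ ^ 2) :
    ∀ f : HilbertBasis ℕ ℂ H, Summable fun i => ‖T (f i)‖ ^ 2 := by
  intro f
  simpa using f.isFrame.summable_norm_adjoint_sq f.isFrame (adjoint T)
    (he.summable_norm_adjoint_sq f.isFrame T h)

end
end

section
/- Let H be a separable complex Hilbert space, let 1 ≤ p < 2, and let T ∈ S_p(H). Then tr|T|^p = inf over all orthonormal bases (f_i) of H of ∑_{i=1}^∞ ‖T f_i‖^p; in particular ∑_i ‖T f_i‖^p ≥ tr|T|^p for every orthonormal basis (f_i), with equality for an eigenbasis of T*T. -/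
open ContinuousLinearMap Filter Topology

noncomputable section

variable {H : Type*} [NormedAddCommGroup H] [InnerProductSpace ℂ H] [CompleteSpace H]
  [TopologicalSpace.SeparableSpace H]

local notation "⟪" x ", " y "⟫" => @inner ℂ _ _ x y

/-- `|T|^p = (T*T)^{p/2}`, via the continuous functional calculus. -/
def absPow (T : H →L[ℂ] H) (p : ℝ) : H →L[ℂ] H :=
  cfc (fun t : ℝ => t ^ (p / 2)) (ContinuousLinearMap.adjoint T ∘L T)

/-- The trace `∑ᵢ ⟨fᵢ, A fᵢ⟩ ∈ [0,∞]` of a positive operator `A`, computed in the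
orthonormal basis `f` (for positive `A` the value is independent of the basis). -/
def posTr (f : HilbertBasis ℕ ℂ H) (A : H →L[ℂ] H) : ENNReal :=
  ∑' i, ENNReal.ofReal (RCLike.re ⟪f i, A (f i)⟫)

/-- `tr |T|^p ∈ [0,∞]`. `T` lies in the Schatten class `S_p(H)` iff this is finite. -/
def trAbsPow (f : HilbertBasis ℕ ℂ H) (T : H →L[ℂ] H) (p : ℝ) : ENNReal :=
  posTr f (absPow T p)

/-- The Schatten `p`-norm `‖T‖_p = (tr |T|^p)^{1/p}`. -/
def sNorm (f : HilbertBasis ℕ ℂ H) (p : ℝ) (T : H →L[ℂ] H) : ℝ :=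
  (trAbsPow f T p).toReal ^ (1 / p)

/-- `T : X → B(H)` belongs to `C₀(X, S_p(H))`: pointwise Schatten class, continuous
with respect to the Schatten `p`-norm, and vanishing at infinity with respect to it. -/
def IsC0Schatten (f : HilbertBasis ℕ ℂ H) (p : ℝ) {X : Type*} [TopologicalSpace X]
    (T : X → H →L[ℂ] H) : Prop :=
  (∀ x, trAbsPow f (T x) p ≠ ⊤) ∧
  (∀ x, Tendsto (fun y => sNorm f p (T y - T x)) (nhds x) (nhds 0)) ∧
  Tendsto (fun x => sNorm f p (T x)) (cocompact X) (nhds 0)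

section
variable {ι E : Type*} [NormedAddCommGroup E] [InnerProductSpace ℂ E]

theorem HilbertBasis.hasSum_norm_inner_sq (f : HilbertBasis ι ℂ E) (x : E) :
    HasSum (fun i => ‖⟪f i, x⟫‖ ^ 2) (‖x‖ ^ 2) := by
  have h := (f.hasSum_inner_mul_inner x x).mapL Complex.reCLM
  have hi : ∀ i, ⟪x, f i⟫ * ⟪f i, x⟫ = ((‖⟪f i, x⟫‖ ^ 2 : ℝ) : ℂ) := fun i => by
    rw [← inner_conj_symm x, ← Complex.normSq_eq_conj_mul_self, Complex.normSq_eq_norm_sq]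
  simp_rw [hi, inner_self_eq_norm_sq_to_K] at h
  simpa [← Complex.ofReal_pow] using h

theorem HilbertBasis.tsum_enorm_inner_sq (f : HilbertBasis ι ℂ E) (x : E) :
    ∑' i, ‖⟪f i, x⟫‖ₑ ^ 2 = ‖x‖ₑ ^ 2 := by
  have h := f.hasSum_norm_inner_sq x
  have h2 := ENNReal.ofReal_tsum_of_nonneg (fun i => by positivity) h.summable
  rw [h.tsum_eq] at h2
  simpa [ENNReal.ofReal_pow, ofReal_norm] using h2.symm

theorem HilbertBasis.orthogonal_span_range_eq_bot [CompleteSpace E] (f : HilbertBasis ι ℂ E) :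
    (Submodule.span ℂ (Set.range f))ᗮ = ⊥ :=
  Submodule.topologicalClosure_eq_top_iff.1 f.dense_span

/-- The Hilbert–Schmidt sum of an operator in one basis is that of its adjoint in any other. -/
theorem HilbertBasis.tsum_enorm_apply_sq_eq_adjoint [CompleteSpace E] {κ : Type*}
    (f : HilbertBasis ι ℂ E) (g : HilbertBasis κ ℂ E) (C : E →L[ℂ] E) :
    ∑' i, ‖C (f i)‖ₑ ^ 2 = ∑' j, ‖adjoint C (g j)‖ₑ ^ 2 := by
  simp_rw [← g.tsum_enorm_inner_sq (C _), ← f.tsum_enorm_inner_sq (adjoint C _)]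
  rw [ENNReal.tsum_comm]
  refine tsum_congr fun j => tsum_congr fun i => ?_
  rw [adjoint_inner_right, ← inner_conj_symm, RCLike.enorm_conj]

theorem HilbertBasis.enorm_sq_le_tsum [CompleteSpace E] (f : HilbertBasis ι ℂ E) (C : E →L[ℂ] E) (x : E) :
    ‖C x‖ₑ ^ 2 ≤ (∑' i, ‖C (f i)‖ₑ ^ 2) * ‖x‖ₑ ^ 2 := by
  rw [f.tsum_enorm_apply_sq_eq_adjoint f, ← f.tsum_enorm_inner_sq, ← ENNReal.tsum_mul_right]
  refine ENNReal.tsum_le_tsum fun i => ?_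
  rw [← adjoint_inner_left, ← mul_pow]
  gcongr
  simp only [enorm_eq_nnnorm]
  exact_mod_cast nnnorm_inner_le_nnnorm _ _

/-- Hilbert–Schmidt operators are compact. -/
theorem HilbertBasis.isCompactOperator_of_tsum_ne_top [CompleteSpace E] (f : HilbertBasis ι ℂ E) (C : E →L[ℂ] E)
    (hC : ∑' i, ‖C (f i)‖ₑ ^ 2 ≠ ⊤) : IsCompactOperator C := by
  classical
  let F : Finset ι → E →L[ℂ] E := fun s =>
    ∑ i ∈ s, (toSpanSingleton ℂ (C (f i))) ∘L (innerSL ℂ (f i))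
  have hF : ∀ s, IsCompactOperator (F s) := fun s =>
    Submodule.sum_mem (compactOperator (RingHom.id ℂ) E E) fun i _ =>
      (isCompactOperator_of_locallyCompactSpace_rng
        (toSpanSingleton ℂ (C (f i)))).comp_clm _
  have happ : ∀ s j, (C - F s) (f j) = if j ∈ s then 0 else C (f j) := by
    intro s j
    have : F s (f j) = if j ∈ s then C (f j) else 0 := by
      simp [F, sum_apply, orthonormal_iff_ite.1 f.orthonormal]
    rw [sub_apply, this]
    split_ifs <;> simp
  have hle : ∀ s, ‖C - F s‖ₑ ^ 2 ≤ ∑' i : {i // i ∉ s}, ‖C (f i)‖ₑ ^ 2 := by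
    intro s
    have hsum : ∑' i, ‖(C - F s) (f i)‖ₑ ^ 2 = ∑' i : {i // i ∉ s}, ‖C (f i)‖ₑ ^ 2 := by
      rw [show (fun i => ‖(C - F s) (f i)‖ₑ ^ 2) =
        Set.indicator {i | i ∉ s} (fun i => ‖C (f i)‖ₑ ^ 2) from ?_, ← tsum_subtype]
      · rfl
      · ext i
        rw [happ]
        by_cases h : i ∈ s <;> simp [h]
    rw [← hsum]
    set S := ∑' i, ‖(C - F s) (f i)‖ₑ ^ 2
    have hS : S ≠ ⊤ := by
      rw [hsum]
      exact ne_top_of_le_ne_top hC (ENNReal.tsum_comp_le_tsum_of_injective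
        Subtype.val_injective (fun i => ‖C (f i)‖ₑ ^ 2))
    have hb : ‖C - F s‖ ≤ √S.toReal := by
      refine opNorm_le_bound _ (Real.sqrt_nonneg _) fun x => ?_
      refine abs_le_of_sq_le_sq' ?_ (by positivity) |>.2
      have h := ENNReal.toReal_mono (ENNReal.mul_ne_top hS (by finiteness))
        (f.enorm_sq_le_tsum (C - F s) x)
      rw [mul_pow, Real.sq_sqrt ENNReal.toReal_nonneg]
      simpa using h
    have h2 : ‖C - F s‖ ^ 2 ≤ S.toReal := by
      rw [← Real.sq_sqrt (ENNReal.toReal_nonneg (a := S))]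
      gcongr
    rw [← ofReal_norm, ← ENNReal.ofReal_pow (norm_nonneg _)]
    exact ENNReal.ofReal_le_of_le_toReal h2
  refine isCompactOperator_of_tendsto (l := atTop) (F := F) ?_ (Eventually.of_forall hF)
  rw [tendsto_iff_edist_tendsto_0]
  have h0 := tendsto_of_tendsto_of_tendsto_of_le_of_le tendsto_const_nhds
    (ENNReal.tendsto_tsum_compl_atTop_zero hC) (fun _ => zero_le) hle
  have h1 := (ENNReal.continuous_rpow_const (y := 1 / 2)).continuousAt.tendsto.comp h0
  refine (h1.congr fun s => ?_).trans (by simp)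
  simp only [Function.comp]
  rw [← ENNReal.rpow_natCast, ← ENNReal.rpow_mul, edist_comm, edist_eq_enorm_sub]
  norm_num

theorem HilbertBasis.countable_of_hilbertBasis {κ : Type*} [Countable κ] (f : HilbertBasis κ ℂ E)
    (b : HilbertBasis ι ℂ E) : Countable ι := by
  have hc : (⋃ n, Function.support fun i => ‖⟪b i, f n⟫‖ ^ 2).Countable :=
    Set.countable_iUnion fun n => (b.hasSum_norm_inner_sq (f n)).summable.countable_support
  rw [← Set.countable_univ_iff]
  refine hc.mono fun i _ => ?_
  by_contra hi
  simp only [Set.mem_iUnion, Function.mem_support, not_exists, not_not] at hi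
  have h0 := f.hasSum_norm_inner_sq (b i)
  simp_rw [norm_inner_symm, hi] at h0
  have := h0.unique hasSum_zero
  rw [b.orthonormal.1 i] at this
  norm_num at this

theorem HilbertBasis.infinite_of_hilbertBasis {κ : Type*} [Infinite κ] (f : HilbertBasis κ ℂ E)
    (b : HilbertBasis ι ℂ E) : Infinite ι := by
  by_contra h
  have : Finite ι := not_infinite_iff_finite.1 h
  have : Fintype ι := Fintype.ofFinite ι
  have : Module.Finite ℂ E := b.toOrthonormalBasis.toBasis.finiteDimensional_of_finite
  have := f.orthonormal.linearIndependent.finite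
  exact not_finite κ

/-- A compact self-adjoint operator on a space with a Hilbert basis indexed by `ℕ` has a Hilbert
basis of eigenvectors indexed by `ℕ`. -/
theorem HilbertBasis.exists_eigenbasis [CompleteSpace E] (f : HilbertBasis ℕ ℂ E) (A : E →L[ℂ] E)
    (hA : IsSelfAdjoint A) (hc : IsCompactOperator A) :
    ∃ g : HilbertBasis ℕ ℂ E, ∀ i, ∃ μ : ℝ, A (g i) = (μ : ℂ) • g i := by
  have hs : A.toLinearMap.IsSymmetric := hA.isSymmetric
  let V : ℂ → Submodule ℂ E := fun μ => Module.End.eigenspace A.toLinearMap μ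
  have hcl : ∀ μ, IsClosed (V μ : Set E) := fun μ => by
    have : (V μ : Set E) = {x | A x = μ • x} := by
      ext x; simp [V]
    rw [this]
    exact isClosed_eq A.continuous (continuous_const_smul μ)
  have : ∀ μ, CompleteSpace (V μ) := fun μ => (hcl μ).completeSpace_coe
  choose w b hb using fun μ => exists_hilbertBasis ℂ (V μ)
  have ho := hs.orthogonalFamily_eigenspaces.orthonormal_sigma_orthonormal
    (v_family := fun μ => b μ) fun μ => (b μ).orthonormal
  let B : HilbertBasis (Σ μ, w μ) ℂ E := HilbertBasis.mkOfOrthogonalEqBot ho (by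
    rw [eq_bot_iff, ← orthogonalComplement_iSup_eigenspaces_eq_bot hc hs,
      ← Submodule.iInf_orthogonal]
    refine le_iInf fun μ x hx => ?_
    rw [Submodule.mem_orthogonal'] at hx ⊢
    intro u hu
    have hle : Submodule.span ℂ (Set.range (b μ)) ≤
        (innerSL ℂ x ∘L (V μ).subtypeL).ker := by
      rw [Submodule.span_le]
      rintro _ ⟨k, rfl⟩
      exact hx _ (Submodule.subset_span ⟨⟨μ, k⟩, rfl⟩)
    have h := Submodule.topologicalClosure_minimal _ hle (ContinuousLinearMap.isClosed_ker _)
    rw [(b μ).dense_span] at h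
    exact h (x := ⟨u, hu⟩) trivial)
  have := f.countable_of_hilbertBasis B
  have := f.infinite_of_hilbertBasis B
  obtain ⟨e⟩ := nonempty_equiv_of_countable (α := ℕ) (β := Σ μ, w μ)
  refine ⟨HilbertBasis.mkOfOrthogonalEqBot (B.orthonormal.comp e e.injective) ?_, fun i => ?_⟩
  · rw [EquivLike.range_comp, B.orthogonal_span_range_eq_bot]
  · have h := (b (e i).1 (e i).2).2
    have hev : Module.End.HasEigenvalue A.toLinearMap (e i).1 :=
      Module.End.hasEigenvalue_of_hasEigenvector
        ⟨h, fun h0 => (b (e i).1).orthonormal.ne_zero (e i).2 (Subtype.ext h0)⟩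
    refine ⟨(e i).1.re, ?_⟩
    rw [Complex.conj_eq_iff_re.1 (hs.conj_eigenvalue_eq_self hev)]
    rw [Module.End.mem_eigenspace_iff] at h
    simpa [B] using h
end

theorem Real.rpow_one_sub_mul_rpow_le {s t q : ℝ} (hs : 0 ≤ s) (ht : 0 ≤ t) (hq0 : 0 ≤ q)
    (hq1 : q ≤ 1) : s ^ (1 - q) * t ^ q ≤ q * t + (1 - q) * s := by
  have := Real.geom_mean_le_arith_mean2_weighted (sub_nonneg.2 hq1) hq0 hs ht (by ring)
  linarith

theorem Real.two_sub_mul_le {m t q : ℝ} (hm : 0 < m) (ht : 0 ≤ t) (hq1 : q ≤ 1) :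
    (2 - q) * t ≤ m ^ (1 - q) * t ^ q + (1 - q) / m * t ^ 2 := by
  rcases ht.eq_or_lt with rfl | ht
  · have : 0 ≤ m ^ (1 - q) * 0 ^ q := by positivity
    simpa using this
  have h2 : (0 : ℝ) < 2 - q := by linarith
  have h := Real.geom_mean_le_arith_mean2_weighted (w₁ := 1 / (2 - q)) (w₂ := (1 - q) / (2 - q))
    (p₁ := m ^ (1 - q) * t ^ q) (p₂ := t ^ 2 / m) (by positivity)
    (div_nonneg (by linarith) h2.le) (by positivity) (by positivity) (by field_simp; ring)
  have he : (m ^ (1 - q) * t ^ q) ^ (1 / (2 - q)) * (t ^ 2 / m) ^ ((1 - q) / (2 - q)) = t := by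
    rw [Real.mul_rpow (by positivity) (by positivity), Real.div_rpow (by positivity) hm.le,
      ← Real.rpow_natCast t 2, ← Real.rpow_mul hm.le, ← Real.rpow_mul ht.le, ← Real.rpow_mul ht.le,
      mul_one_div, mul_one_div, mul_div_assoc', mul_assoc, mul_div_cancel_left₀ _ (by positivity),
      ← Real.rpow_add ht]
    convert Real.rpow_one t using 2
    push_cast
    field_simp
    ring
  rw [he] at h
  field_simp at h ⊢
  linarith

section
variable {E : Type*} [NormedAddCommGroup E] [InnerProductSpace ℂ E]

theorem ContinuousLinearMap.re_inner_apply_mono {A B : E →L[ℂ] E} (h : A ≤ B) (x : E) :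
    RCLike.re ⟪x, A x⟫ ≤ RCLike.re ⟪x, B x⟫ := by
  have := ((ContinuousLinearMap.le_def A B).1 h).re_inner_nonneg_right x
  simpa [inner_sub_right] using this

variable [CompleteSpace E]

theorem ContinuousLinearMap.spectrum_real_nonneg {A : E →L[ℂ] E} (hA : 0 ≤ A) {t : ℝ}
    (ht : t ∈ spectrum ℝ A) : 0 ≤ t :=
  spectrum_nonneg_of_nonneg hA ht

/-- Jensen's inequality for the concave function `t ↦ t ^ q`. -/
theorem ContinuousLinearMap.re_inner_cfc_rpow_le {A : E →L[ℂ] E} (hA : 0 ≤ A) {q : ℝ}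
    (hq0 : 0 < q) (hq1 : q ≤ 1) {x : E} (hx : ‖x‖ = 1) :
    RCLike.re ⟪x, cfc (fun t : ℝ => t ^ q) A x⟫ ≤ (RCLike.re ⟪x, A x⟫) ^ q := by
  have hsa : IsSelfAdjoint A := .of_nonneg hA
  have hcont : ContinuousOn (fun t : ℝ => t ^ q) (spectrum ℝ A) :=
    (Real.continuous_rpow_const hq0.le).continuousOn
  have key : ∀ s : ℝ, 0 ≤ s → s ^ (1 - q) * RCLike.re ⟪x, cfc (fun t : ℝ => t ^ q) A x⟫ ≤
      q * RCLike.re ⟪x, A x⟫ + (1 - q) * s := by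
    intro s hs
    have h : cfc (fun t : ℝ => s ^ (1 - q) * t ^ q) A ≤ cfc (fun t : ℝ => q * t + (1 - q) * s) A :=
      cfc_mono fun t ht => Real.rpow_one_sub_mul_rpow_le hs (spectrum_real_nonneg hA ht) hq0.le hq1
    rw [cfc_const_mul _ _ A hcont, cfc_add .., cfc_const_mul .., cfc_const .., cfc_id' ..] at h
    have := re_inner_apply_mono h x
    simpa [inner_add_right, inner_smul_right_eq_smul, Algebra.algebraMap_eq_smul_one, hx] using this
  have ha : 0 ≤ RCLike.re ⟪x, A x⟫ :=
    ((nonneg_iff_isPositive A).1 hA).re_inner_nonneg_right x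
  set a := RCLike.re ⟪x, A x⟫
  set y := RCLike.re ⟪x, cfc (fun t : ℝ => t ^ q) A x⟫
  rcases ha.eq_or_lt with ha0 | ha0
  · rw [← ha0, Real.zero_rpow hq0.ne']
    by_contra! hy
    have h := key (y ^ q⁻¹) (by positivity)
    have hz : (y ^ q⁻¹) ^ (1 - q) * y = y ^ q⁻¹ := by
      nth_rw 2 [← Real.rpow_inv_rpow hy.le hq0.ne']
      rw [← Real.rpow_add (by positivity)]
      simp
    rw [hz, ← ha0] at h
    have : 0 < y ^ q⁻¹ := by positivity
    nlinarith
  · have h := key a ha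
    have h1 : a ^ (1 - q) * a ^ q = a := by rw [← Real.rpow_add ha0]; simp
    refine le_of_mul_le_mul_left (a := a ^ (1 - q)) ?_ (by positivity)
    linarith

theorem ContinuousLinearMap.rpow_le_re_inner_cfc_of_eigenvector {A : E →L[ℂ] E} (hA : 0 ≤ A) {q : ℝ}
    (hq0 : 0 < q) (hq1 : q ≤ 1) {x : E} (hx : ‖x‖ = 1) {m : ℝ} (hm : 0 ≤ m)
    (hAx : A x = (m : ℂ) • x) :
    m ^ q ≤ RCLike.re ⟪x, cfc (fun t : ℝ => t ^ q) A x⟫ := by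
  have hsa : IsSelfAdjoint A := .of_nonneg hA
  have hcont : ContinuousOn (fun t : ℝ => t ^ q) (spectrum ℝ A) :=
    (Real.continuous_rpow_const hq0.le).continuousOn
  rcases hm.eq_or_lt with rfl | hm
  · rw [Real.zero_rpow hq0.ne']
    exact ((nonneg_iff_isPositive _).1 (cfc_nonneg fun t ht =>
      Real.rpow_nonneg (spectrum_real_nonneg hA ht) q)).re_inner_nonneg_right x
  have h : cfc (fun t : ℝ => (2 - q) * t) A ≤
      cfc (fun t : ℝ => m ^ (1 - q) * t ^ q + (1 - q) / m * t ^ 2) A :=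
    cfc_mono fun t ht => Real.two_sub_mul_le hm (spectrum_real_nonneg hA ht) hq1
  rw [cfc_add .., cfc_const_mul .., cfc_const_mul _ _ A hcont, cfc_const_mul .., cfc_id' ..,
    cfc_pow_id ..] at h
  have h := re_inner_apply_mono h x
  have hA1 : ⟪x, A x⟫ = (m : ℂ) := by simp [hAx, hx]
  have hA2 : ⟪x, (A ^ 2) x⟫ = (m ^ 2 : ℝ) := by
    simp [pow_two, hAx, hx]
  simp only [add_apply, smul_apply, inner_add_right, inner_smul_right_eq_smul, hA1, hA2,
    RCLike.smul_re, map_add] at h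
  set y := RCLike.re ⟪x, cfc (fun t : ℝ => t ^ q) A x⟫
  have h1 : m ^ (1 - q) * m ^ q = m := by rw [← Real.rpow_add hm]; simp
  have h2 : (1 - q) / m * m ^ 2 = (1 - q) * m := by field_simp
  refine le_of_mul_le_mul_left (a := m ^ (1 - q)) ?_ (by positivity)
  simp [-Complex.ofReal_pow] at h
  linarith
theorem nonneg_adjoint_comp_self (T : E →L[ℂ] E) : 0 ≤ adjoint T ∘L T :=
  (nonneg_iff_isPositive _).2 (isPositive_adjoint_comp_self T)

theorem re_inner_adjoint_comp_self (T : E →L[ℂ] E) (x : E) :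
    RCLike.re ⟪x, (adjoint T ∘L T) x⟫ = ‖T x‖ ^ 2 := by
  rw [comp_apply, adjoint_inner_right, inner_self_eq_norm_sq]

/-- `|T|^p` is the square of the self-adjoint operator `|T|^(p/2)`. -/
theorem absPow_half_mul_self (T : E →L[ℂ] E) {p : ℝ} (hp : 0 ≤ p) :
    absPow T (p / 2) * absPow T (p / 2) = absPow T p := by
  have hc : ContinuousOn (fun t : ℝ => t ^ (p / 2 / 2)) (spectrum ℝ (adjoint T ∘L T)) :=
    (Real.continuous_rpow_const (by positivity)).continuousOn
  rw [absPow, ← cfc_mul _ _ _ hc hc]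
  refine cfc_congr fun t ht => ?_
  have ht0 := spectrum_real_nonneg (nonneg_adjoint_comp_self T) ht
  rw [← Real.rpow_add_of_nonneg ht0 (by positivity) (by positivity), add_halves]

theorem adjoint_absPow (T : E →L[ℂ] E) (p : ℝ) : adjoint (absPow T p) = absPow T p :=
  (cfc_predicate (R := ℝ) (p := IsSelfAdjoint) _ (adjoint T ∘L T)).adjoint_eq

theorem trAbsPow_eq_tsum (f : HilbertBasis ℕ ℂ E) (T : E →L[ℂ] E) {p : ℝ} (hp : 0 ≤ p) :
    trAbsPow f T p = ∑' i, ‖absPow T (p / 2) (f i)‖ₑ ^ 2 := by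
  refine tsum_congr fun i => ?_
  rw [← absPow_half_mul_self T hp, mul_apply_eq_comp, ← adjoint_inner_left, adjoint_absPow,
    inner_self_eq_norm_sq, ENNReal.ofReal_pow (norm_nonneg _), ofReal_norm]

/-- The trace of `|T|^p` is independent of the basis. -/
theorem trAbsPow_eq (f g : HilbertBasis ℕ ℂ E) (T : E →L[ℂ] E) {p : ℝ} (hp : 0 ≤ p) :
    trAbsPow f T p = trAbsPow g T p := by
  rw [trAbsPow_eq_tsum f T hp, trAbsPow_eq_tsum g T hp,
    f.tsum_enorm_apply_sq_eq_adjoint g, adjoint_absPow]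

theorem isCompactOperator_adjoint_comp_self (f : HilbertBasis ℕ ℂ E) (T : E →L[ℂ] E) {p : ℝ}
    (hp0 : 0 ≤ p) (hp4 : p < 4) (hT : trAbsPow f T p ≠ ⊤) :
    IsCompactOperator (adjoint T ∘L T) := by
  rw [trAbsPow_eq_tsum f T hp0] at hT
  have hC := (f.isCompactOperator_of_tsum_ne_top _ hT).comp_clm (absPow T (2 - p / 2))
  have h : absPow T (p / 2) * absPow T (2 - p / 2) = adjoint T ∘L T := by
    have hsa : IsSelfAdjoint (adjoint T ∘L T) := .of_nonneg (nonneg_adjoint_comp_self T)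
    have hc : ∀ r : ℝ, 0 ≤ r → ContinuousOn (fun t : ℝ => t ^ r) (spectrum ℝ (adjoint T ∘L T)) :=
      fun r hr => (Real.continuous_rpow_const hr).continuousOn
    rw [absPow, absPow, ← cfc_mul _ _ _ (hc _ (by positivity)) (hc _ (by linarith))]
    conv_rhs => rw [← cfc_id' ℝ (adjoint T ∘L T)]
    refine cfc_congr fun t ht => ?_
    have ht0 := spectrum_real_nonneg (nonneg_adjoint_comp_self T) ht
    rw [← Real.rpow_add_of_nonneg ht0 (by positivity) (by linarith)]
    ring_nf
    exact Real.rpow_one t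
  rw [← h]
  exact hC

theorem re_inner_absPow_le (T : E →L[ℂ] E) {p : ℝ} (hp0 : 0 < p) (hp2 : p ≤ 2) {x : E}
    (hx : ‖x‖ = 1) : RCLike.re ⟪x, absPow T p x⟫ ≤ ‖T x‖ ^ p := by
  have h := re_inner_cfc_rpow_le (nonneg_adjoint_comp_self T) (q := p / 2) (by positivity)
    (by linarith) hx
  rwa [re_inner_adjoint_comp_self, ← Real.rpow_natCast, ← Real.rpow_mul (norm_nonneg _),
    Nat.cast_ofNat, mul_div_cancel₀ _ two_ne_zero] at h

theorem norm_rpow_le_re_inner_absPow (T : E →L[ℂ] E) {p : ℝ} (hp0 : 0 < p) (hp2 : p ≤ 2) {x : E}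
    (hx : ‖x‖ = 1) {m : ℝ} (h : (adjoint T ∘L T) x = (m : ℂ) • x) :
    ‖T x‖ ^ p ≤ RCLike.re ⟪x, absPow T p x⟫ := by
  have hm : m = ‖T x‖ ^ 2 := by
    rw [← re_inner_adjoint_comp_self, h]
    simp [hx]
  have h := rpow_le_re_inner_cfc_of_eigenvector (nonneg_adjoint_comp_self T) (q := p / 2)
    (by positivity) (by linarith) hx (hm ▸ by positivity) h
  rwa [hm, ← Real.rpow_natCast, ← Real.rpow_mul (norm_nonneg _),
    Nat.cast_ofNat, mul_div_cancel₀ _ two_ne_zero] at h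

end

/-- for `1 ≤ p < 2` and `T ∈ S_p(H)`, `tr|T|^p` is the infimum over
orthonormal bases `g` of `∑ᵢ ‖T gᵢ‖^p`; in particular every orthonormal basis gives an
upper bound, and an eigenbasis of `T*T` attains it. -/
theorem trAbsPow_eq_iInf_of_lt_two (f : HilbertBasis ℕ ℂ H) (p : ℝ)
    (hp1 : 1 ≤ p) (hp2 : p < 2) (T : H →L[ℂ] H) (hT : trAbsPow f T p ≠ ⊤) :
    trAbsPow f T p =
      (⨅ g : HilbertBasis ℕ ℂ H, ∑' i, ENNReal.ofReal (‖T (g i)‖ ^ p)) ∧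
    (∀ g : HilbertBasis ℕ ℂ H,
      trAbsPow f T p ≤ ∑' i, ENNReal.ofReal (‖T (g i)‖ ^ p)) ∧
    (∃ g : HilbertBasis ℕ ℂ H,
      (∀ i, ∃ μ : ℝ, (ContinuousLinearMap.adjoint T ∘L T) (g i) = (μ : ℂ) • g i) ∧
      ∑' i, ENNReal.ofReal (‖T (g i)‖ ^ p) = trAbsPow f T p) := by
  have hle : ∀ g : HilbertBasis ℕ ℂ H,
      trAbsPow f T p ≤ ∑' i, ENNReal.ofReal (‖T (g i)‖ ^ p) := fun g => by
    rw [trAbsPow_eq f g T (by linarith)]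
    exact ENNReal.tsum_le_tsum fun i => ENNReal.ofReal_le_ofReal
      (re_inner_absPow_le T (by linarith) hp2.le (g.orthonormal.1 i))
  have hsa : IsSelfAdjoint (adjoint T ∘L T) := .of_nonneg (nonneg_adjoint_comp_self T)
  obtain ⟨g, hg⟩ := f.exists_eigenbasis _ hsa
    (isCompactOperator_adjoint_comp_self f T (by linarith) (by linarith) hT)
  have heq : ∑' i, ENNReal.ofReal (‖T (g i)‖ ^ p) = trAbsPow f T p := by
    refine le_antisymm ?_ (hle g)
    rw [trAbsPow_eq f g T (by linarith)]
    refine ENNReal.tsum_le_tsum fun i => ENNReal.ofReal_le_ofReal ?_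
    obtain ⟨m, hm⟩ := hg i
    exact norm_rpow_le_re_inner_absPow T (by linarith) hp2.le (g.orthonormal.1 i) hm
  exact ⟨le_antisymm (le_iInf hle) (heq ▸ iInf_le _ g), hle, g, hg, heq⟩

end
end
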